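/- Let n ≥ 3 and g ∈ SL(n,ℤ). If the discriminant of the characteristic polynomial of g is nonzero, then there exists a unipotent u ∈ SL(n,ℤ) such that ⟨g, u^m⟩ has finite index in SL(n,ℤ) for every m ≥ 1. -/

import Mathlib

section Auxiliary

open Matrix
open scoped commutatorElement

section Transvections
variable {ι : Type*} [Fintype ι] [DecidableEq ι]

/-- `HasTransvection H w h` says that `1 + w hᵀ` is (the matrix of) an element of `H`. -/
def HasTransvection (H : Subgroup (Matrix.SpecialLinearGroup ι ℤ)) (w h : ι → ℤ) : Prop :=
  ∃ γ ∈ H, (γ : Matrix ι ι ℤ) = 1 + vecMulVec w h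

namespace HasTransvection

variable {H : Subgroup (Matrix.SpecialLinearGroup ι ℤ)} {w w' h h' : ι → ℤ}

theorem of_smul_left {a : ℤ} (hT : HasTransvection H (a • w) h) : HasTransvection H w (a • h) := by
  simpa only [HasTransvection, smul_vecMulVec, vecMulVec_smul] using hT

theorem of_smul_right {a : ℤ} (hT : HasTransvection H w (a • h)) : HasTransvection H (a • w) h := by
  simpa only [HasTransvection, smul_vecMulVec, vecMulVec_smul] using hT

theorem zero_left : HasTransvection H 0 h := ⟨1, H.one_mem, by simp⟩

theorem zero_right : HasTransvection H w 0 := ⟨1, H.one_mem, by simp⟩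

theorem add_left (hw' : h ⬝ᵥ w' = 0) (hT : HasTransvection H w h)
    (hT' : HasTransvection H w' h) : HasTransvection H (w + w') h := by
  obtain ⟨γ, hγ, e⟩ := hT
  obtain ⟨γ', hγ', e'⟩ := hT'
  refine ⟨γ * γ', H.mul_mem hγ hγ', ?_⟩
  simp [e, e', mul_add, add_mul, vecMulVec_mul_vecMulVec, hw', add_vecMulVec, add_assoc]

theorem add_right (hw : h ⬝ᵥ w = 0) (hT : HasTransvection H w h)
    (hT' : HasTransvection H w h') : HasTransvection H w (h + h') := by
  obtain ⟨γ, hγ, e⟩ := hT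
  obtain ⟨γ', hγ', e'⟩ := hT'
  refine ⟨γ * γ', H.mul_mem hγ hγ', ?_⟩
  simp [e, e', mul_add, add_mul, vecMulVec_mul_vecMulVec, hw, vecMulVec_add, add_assoc]

theorem coe_inv_eq (hw : h ⬝ᵥ w = 0) {γ : Matrix.SpecialLinearGroup ι ℤ}
    (e : (γ : Matrix ι ι ℤ) = 1 + vecMulVec w h) :
    ((γ⁻¹ : Matrix.SpecialLinearGroup ι ℤ) : Matrix ι ι ℤ) = 1 - vecMulVec w h := by
  have h1 : ((γ⁻¹ : Matrix.SpecialLinearGroup ι ℤ) : Matrix ι ι ℤ) * γ = 1 := by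
    rw [← Matrix.SpecialLinearGroup.coe_mul]; simp
  have h2 : (γ : Matrix ι ι ℤ) * (1 - vecMulVec w h) = 1 := by
    simp [e, mul_sub, add_mul, vecMulVec_mul_vecMulVec, hw]
  calc _ = ((γ⁻¹ : Matrix.SpecialLinearGroup ι ℤ) : Matrix ι ι ℤ) * (γ * (1 - vecMulVec w h)) := by
        rw [h2, mul_one]
    _ = _ := by rw [← mul_assoc, h1, one_mul]

theorem neg_right (hw : h ⬝ᵥ w = 0) (hT : HasTransvection H w h) :
    HasTransvection H w (-h) := by
  obtain ⟨γ, hγ, e⟩ := hT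
  refine ⟨γ⁻¹, H.inv_mem hγ, ?_⟩
  rw [coe_inv_eq hw e, vecMulVec_neg, sub_eq_add_neg]

theorem smul_right (hw : h ⬝ᵥ w = 0) (hT : HasTransvection H w h) (a : ℤ) :
    HasTransvection H w (a • h) := by
  induction a using Int.induction_on with
  | zero => simpa using zero_right
  | succ k ih =>
    rw [add_smul, one_smul]
    exact add_right (by rw [smul_dotProduct, hw, smul_zero]) ih hT
  | pred k ih =>
    rw [sub_smul, one_smul, sub_eq_add_neg]
    exact add_right (by rw [smul_dotProduct, hw, smul_zero]) ih (neg_right hw hT)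

theorem smul_left (hw : h ⬝ᵥ w = 0) (hT : HasTransvection H w h) (a : ℤ) :
    HasTransvection H (a • w) h :=
  of_smul_right (smul_right hw hT a)

theorem sum_left {κ : Type*} (s : Finset κ) (f : κ → ι → ℤ) (hf : ∀ k ∈ s, h ⬝ᵥ f k = 0)
    (hT : ∀ k ∈ s, HasTransvection H (f k) h) : HasTransvection H (∑ k ∈ s, f k) h := by
  refine (Finset.sum_induction f (fun x => h ⬝ᵥ x = 0 ∧ HasTransvection H x h) ?_ ?_ ?_).2
  · rintro a b ⟨ha, ha'⟩ ⟨hb, hb'⟩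
    exact ⟨by simp [ha, hb], add_left hb ha' hb'⟩
  · exact ⟨by simp, zero_left⟩
  · exact fun k hk => ⟨hf k hk, hT k hk⟩

theorem sum_right {κ : Type*} (s : Finset κ) (f : κ → ι → ℤ) (hf : ∀ k ∈ s, f k ⬝ᵥ w = 0)
    (hT : ∀ k ∈ s, HasTransvection H w (f k)) : HasTransvection H w (∑ k ∈ s, f k) := by
  refine (Finset.sum_induction f (fun x => x ⬝ᵥ w = 0 ∧ HasTransvection H w x) ?_ ?_ ?_).2
  · rintro a b ⟨ha, ha'⟩ ⟨hb, hb'⟩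
    exact ⟨by simp [ha, hb], add_right ha ha' hb'⟩
  · exact ⟨by simp, zero_right⟩
  · exact fun k hk => ⟨hf k hk, hT k hk⟩

theorem commutator (hw : h ⬝ᵥ w = 0) (hw' : h' ⬝ᵥ w' = 0) (hw'h : h' ⬝ᵥ w = 0)
    {γ γ' : Matrix.SpecialLinearGroup ι ℤ} (e : (γ : Matrix ι ι ℤ) = 1 + vecMulVec w h)
    (e' : (γ' : Matrix ι ι ℤ) = 1 + vecMulVec w' h') :
    ((⁅γ, γ'⁆ : Matrix.SpecialLinearGroup ι ℤ) : Matrix ι ι ℤ) =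
      1 + vecMulVec w ((h ⬝ᵥ w') • h') := by
  rw [commutatorElement_def, Matrix.SpecialLinearGroup.coe_mul, Matrix.SpecialLinearGroup.coe_mul,
    Matrix.SpecialLinearGroup.coe_mul, coe_inv_eq hw e, coe_inv_eq hw' e', e, e']
  simp only [mul_sub, mul_add, add_mul, sub_mul, mul_one, one_mul, vecMulVec_mul_vecMulVec, hw, hw',
    hw'h, smul_dotProduct, zero_smul, smul_zero, zero_mul, vecMulVec_zero]
  abel

theorem of_commutator (hw : h ⬝ᵥ w = 0) (hw' : h' ⬝ᵥ w' = 0) (hw'h : h' ⬝ᵥ w = 0)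
    (hT : HasTransvection H w h) (hT' : HasTransvection H w' h') :
    HasTransvection H w ((h ⬝ᵥ w') • h') := by
  obtain ⟨γ, hγ, e⟩ := hT
  obtain ⟨γ', hγ', e'⟩ := hT'
  refine ⟨⁅γ, γ'⁆, ?_, commutator hw hw' hw'h e e'⟩
  rw [commutatorElement_def]
  exact H.mul_mem (H.mul_mem (H.mul_mem hγ hγ') (H.inv_mem hγ)) (H.inv_mem hγ')

theorem coe_conj (b : Matrix.SpecialLinearGroup ι ℤ) {γ : Matrix.SpecialLinearGroup ι ℤ}
    (e : (γ : Matrix ι ι ℤ) = 1 + vecMulVec w h) :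
    ((b * γ * b⁻¹ : Matrix.SpecialLinearGroup ι ℤ) : Matrix ι ι ℤ) =
      1 + vecMulVec ((b : Matrix ι ι ℤ) *ᵥ w)
        (h ᵥ* ((b⁻¹ : Matrix.SpecialLinearGroup ι ℤ) : Matrix ι ι ℤ)) := by
  have h1 : (b : Matrix ι ι ℤ) * ((b⁻¹ : Matrix.SpecialLinearGroup ι ℤ) : Matrix ι ι ℤ) = 1 := by
    rw [← Matrix.SpecialLinearGroup.coe_mul]; simp
  rw [Matrix.SpecialLinearGroup.coe_mul, Matrix.SpecialLinearGroup.coe_mul, e, mul_add,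
    add_mul, mul_one, h1, mul_vecMulVec, vecMulVec_mul]

theorem conj {b : Matrix.SpecialLinearGroup ι ℤ} (hb : b ∈ H) (hT : HasTransvection H w h) :
    HasTransvection H ((b : Matrix ι ι ℤ) *ᵥ w)
        (h ᵥ* ((b⁻¹ : Matrix.SpecialLinearGroup ι ℤ) : Matrix ι ι ℤ)) := by
  obtain ⟨γ, hγ, e⟩ := hT
  exact ⟨b * γ * b⁻¹, H.mul_mem (H.mul_mem hb hγ) (H.inv_mem hb), coe_conj b e⟩

theorem exists_of_dotProduct_eq_zero (hw : h ⬝ᵥ w = 0) :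
    HasTransvection (⊤ : Subgroup (Matrix.SpecialLinearGroup ι ℤ)) w h :=
  ⟨⟨1 + vecMulVec w h, by
    rw [vecMulVec_eq Unit, det_one_add_replicateCol_mul_replicateRow, hw, add_zero]⟩, trivial, rfl⟩

end HasTransvection

end Transvections

section Transvections
variable {ι : Type*} [Fintype ι] [DecidableEq ι]

theorem adjugate_row_dotProduct_col (P : Matrix ι ι ℤ) (i j : ι) :
    P.adjugate.row i ⬝ᵥ P.col j = if i = j then P.det else 0 := by
  change (P.adjugate * P) i j = _
  simp [adjugate_mul, Matrix.one_apply]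

theorem det_smul_eq_sum_col (P : Matrix ι ι ℤ) (w : ι → ℤ) :
    P.det • w = ∑ i, (P.adjugate.row i ⬝ᵥ w) • P.col i := by
  have h : P *ᵥ (P.adjugate *ᵥ w) = P.det • w := by
    rw [mulVec_mulVec, mul_adjugate, smul_mulVec, one_mulVec]
  rw [← h, mulVec_eq_sum]
  simp only [op_smul_eq_smul]
  rfl

theorem det_smul_eq_sum_row (P : Matrix ι ι ℤ) (h : ι → ℤ) :
    P.det • h = ∑ i, (h ⬝ᵥ P.col i) • P.adjugate.row i := by
  have e : (h ᵥ* P) ᵥ* P.adjugate = P.det • h := by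
    rw [vecMul_vecMul, mul_adjugate, vecMul_smul, vecMul_one]
  rw [← e, vecMul_eq_sum]
  rfl

namespace HasTransvection
variable {H : Subgroup (Matrix.SpecialLinearGroup ι ℤ)}

/-- The Koszul relation `f = φⱼ(w) φᵢ - φᵢ(w) φⱼ` vanishes at `w`; transvections along it can be
assembled from the elementary ones in the basis given by the columns of `P`. -/
theorem koszul {P : Matrix ι ι ℤ} {N : ℤ} (hι : 3 ≤ Fintype.card ι)
    (hT : ∀ i j, i ≠ j → HasTransvection H (P.col i) (N • P.adjugate.row j))
    (w : ι → ℤ) {i j : ι} (hij : i ≠ j) :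
    HasTransvection H (P.det • w) ((N * P.det * N) •
      ((P.adjugate.row j ⬝ᵥ w) • P.adjugate.row i -
        (P.adjugate.row i ⬝ᵥ w) • P.adjugate.row j)) := by
  have hΦ := adjugate_row_dotProduct_col P
  set D := P.det
  set Φ := P.adjugate.row
  set V := P.col
  set f := (Φ j ⬝ᵥ w) • Φ i - (Φ i ⬝ᵥ w) • Φ j with hf
  have hfV : ∀ k, k ≠ i → k ≠ j → f ⬝ᵥ V k = 0 := fun k hki hkj => by
    rw [hf, sub_dotProduct, smul_dotProduct, smul_dotProduct, hΦ, hΦ, if_neg hki.symm,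
      if_neg hkj.symm]
    simp
  set y := (Φ i ⬝ᵥ w) • V i + (Φ j ⬝ᵥ w) • V j with hy
  have hfy : f ⬝ᵥ y = 0 := by
    simp only [hf, hy, sub_dotProduct, smul_dotProduct, dotProduct_add, dotProduct_smul, hΦ,
      if_neg hij, if_neg hij.symm, if_true, smul_eq_mul]
    ring
  have hsplit : P.det • w = ∑ k ∈ (Finset.univ.erase i).erase j, (Φ k ⬝ᵥ w) • V k + y := by
    rw [det_smul_eq_sum_col, ← Finset.add_sum_erase _ _ (Finset.mem_univ i),
      ← Finset.add_sum_erase (Finset.univ.erase i) _ (Finset.mem_erase.2 ⟨hij.symm,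
        Finset.mem_univ j⟩), hy]
    abel
  change HasTransvection H (P.det • w) _
  rw [hsplit]
  refine add_left (by rw [smul_dotProduct, hfy, smul_zero]) (sum_left _ _ ?_ ?_) ?_
  · intro k hk
    simp only [Finset.mem_erase, Finset.mem_univ, and_true, ne_eq] at hk
    rw [smul_dotProduct, dotProduct_smul, hfV k hk.2 hk.1, smul_zero, smul_zero]
  · intro k hk
    simp only [Finset.mem_erase, Finset.mem_univ, and_true, ne_eq] at hk
    have h0 : ∀ l, l ≠ k → N • Φ l ⬝ᵥ V k = 0 := fun l hl => by
      rw [smul_dotProduct, hΦ, if_neg hl, smul_zero]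
    have h1 := h0 i (Ne.symm hk.2)
    have h2 := h0 j (Ne.symm hk.1)
    refine smul_left (by rw [smul_dotProduct, hfV k hk.2 hk.1, smul_zero]) ?_ _
    have e : (N * D * N) • f = (N * D * (Φ j ⬝ᵥ w)) • N • Φ i
        + (-(N * D * (Φ i ⬝ᵥ w))) • N • Φ j := by
      rw [hf]; module
    rw [e]
    exact add_right (by rw [smul_dotProduct, h1, smul_zero])
      (smul_right h1 (hT k i hk.2) _) (smul_right h2 (hT k j hk.1) _)
  · obtain ⟨k, hki, hkj⟩ : ∃ k, k ≠ i ∧ k ≠ j := by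
      by_contra! hk
      have : (Finset.univ : Finset ι) ⊆ {i, j} := fun k _ => by
        by_cases hki : k = i
        · simp [hki]
        · simp [hk k hki]
      have := Finset.card_le_card this
      rw [Finset.card_univ] at this
      have := Finset.card_le_two (a := i) (b := j)
      omega
    have h1 : ∀ l, l ≠ k → N • Φ k ⬝ᵥ V l = 0 := fun l hl => by
      rw [smul_dotProduct, hΦ, if_neg hl.symm, smul_zero]
    have h2 : ∀ l, l ≠ k → N • Φ l ⬝ᵥ V k = 0 := fun l hl => by
      rw [smul_dotProduct, hΦ, if_neg hl, smul_zero]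
    have hky : N • Φ k ⬝ᵥ y = 0 := by
      rw [hy, dotProduct_add, dotProduct_smul, dotProduct_smul, h1 i hki.symm, h1 j hkj.symm]
      simp
    have hX : HasTransvection H y (N • Φ k) :=
      add_left (by rw [dotProduct_smul, h1 j hkj.symm, smul_zero])
        (smul_left (h1 i hki.symm) (hT i k hki.symm) _)
        (smul_left (h1 j hkj.symm) (hT j k hkj.symm) _)
    have hY : HasTransvection H (V k) (N • f) := by
      have e : N • f = (Φ j ⬝ᵥ w) • N • Φ i + (-(Φ i ⬝ᵥ w)) • N • Φ j := by
        rw [hf]; module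
      rw [e]
      exact add_right (by rw [smul_dotProduct, h2 i hki.symm, smul_zero])
        (smul_right (h2 i hki.symm) (hT k i hki) _) (smul_right (h2 j hkj.symm) (hT k j hkj) _)
    have := of_commutator hky (by rw [smul_dotProduct, hfV k hki hkj, smul_zero])
      (by rw [smul_dotProduct, hfy, smul_zero]) hX hY
    rwa [smul_dotProduct, hΦ, if_pos rfl, smul_smul, smul_eq_mul] at this

theorem of_basis {P : Matrix ι ι ℤ} {N : ℤ} (hι : 3 ≤ Fintype.card ι)
    (hT : ∀ i j, i ≠ j → HasTransvection H (P.col i) (N • P.adjugate.row j))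
    {w h s : ι → ℤ} (hw : h ⬝ᵥ w = 0) (hs : s ⬝ᵥ w = 1) :
    HasTransvection H w ((N ^ 2 * P.det ^ 4) • h) := by
  have hrow := det_smul_eq_sum_row P h
  have hcol : ∀ r : ι → ℤ, ∑ i, (r ⬝ᵥ P.col i) * (P.adjugate.row i ⬝ᵥ w) = P.det * (r ⬝ᵥ w) := by
    intro r
    rw [← smul_eq_mul P.det, ← dotProduct_smul, det_smul_eq_sum_col, dotProduct_sum]
    simp only [dotProduct_smul, smul_eq_mul, mul_comm]
  have hcolh := hcol h
  have hcols := hcol s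
  rw [hw, mul_zero] at hcolh
  rw [hs, mul_one] at hcols
  have hk := fun i j (hij : i ≠ j) => koszul hι hT w hij
  set D := P.det
  set Φ := P.adjugate.row
  set V := P.col
  set f : ι → ι → ι → ℤ := fun i j => (Φ j ⬝ᵥ w) • Φ i - (Φ i ⬝ᵥ w) • Φ j with hf
  have hfw : ∀ i j, f i j ⬝ᵥ w = 0 := fun i j => by
    simp only [hf, sub_dotProduct, smul_dotProduct, smul_eq_mul]
    ring
  have hsum : (D ^ 2) • h = ∑ i, ∑ j, ((h ⬝ᵥ V i) * (s ⬝ᵥ V j)) • f i j := by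
    have e1 : ∀ i j, ((h ⬝ᵥ V i) * (s ⬝ᵥ V j)) • f i j =
        ((s ⬝ᵥ V j) * (Φ j ⬝ᵥ w)) • (h ⬝ᵥ V i) • Φ i -
          ((h ⬝ᵥ V i) * (Φ i ⬝ᵥ w)) • (s ⬝ᵥ V j) • Φ j := fun i j => by
      simp only [hf]; module
    simp only [e1, Finset.sum_sub_distrib, ← Finset.sum_smul, ← Finset.smul_sum, hcols]
    rw [← hrow, hcolh, zero_smul, sub_zero, smul_smul, sq]
  have hD : HasTransvection H (D • w) ((N * D * N) • (D ^ 2) • h) := by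
    rw [hsum, Finset.smul_sum]
    refine sum_right _ _ (fun i _ => ?_) (fun i _ => ?_)
    · rw [smul_dotProduct, sum_dotProduct]
      simp [dotProduct_smul, smul_dotProduct, hfw, -zsmul_eq_mul]
    rw [Finset.smul_sum]
    refine sum_right _ _ (fun j _ => ?_) (fun j _ => ?_)
    · simp [dotProduct_smul, smul_dotProduct, hfw, -zsmul_eq_mul]
    by_cases hij : i = j
    · have : f i j = 0 := by simp [hf, hij]
      rw [this, smul_zero, smul_zero]
      exact zero_right
    · rw [smul_comm]
      refine smul_right ?_ (hk i j hij) _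
      change ((N * D * N) • f i j) ⬝ᵥ (D • w) = 0
      simp [dotProduct_smul, smul_dotProduct, hfw, -zsmul_eq_mul]
  convert of_smul_left hD using 1
  module

theorem normalCore {M : ℤ}
    (hT : ∀ w h s : ι → ℤ, h ⬝ᵥ w = 0 → s ⬝ᵥ w = 1 → HasTransvection H w (M • h))
    {w h s : ι → ℤ} (hw : h ⬝ᵥ w = 0) (hs : s ⬝ᵥ w = 1) :
    HasTransvection H.normalCore w (M • h) := by
  obtain ⟨γ, hγ, e⟩ := hT w h s hw hs
  refine ⟨γ, fun b => ?_, e⟩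
  have hb : ((b⁻¹ : Matrix.SpecialLinearGroup ι ℤ) : Matrix ι ι ℤ) * (b : Matrix ι ι ℤ) = 1 := by
    rw [← Matrix.SpecialLinearGroup.coe_mul]; simp
  have key : ∀ r : ι → ℤ, (r ᵥ* ((b⁻¹ : Matrix.SpecialLinearGroup ι ℤ) : Matrix ι ι ℤ)) ⬝ᵥ
      ((b : Matrix ι ι ℤ) *ᵥ w) = r ⬝ᵥ w := fun r => by
    rw [dotProduct_mulVec, vecMul_vecMul, hb, vecMul_one]
  obtain ⟨γ', hγ', e'⟩ := hT ((b : Matrix ι ι ℤ) *ᵥ w)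
    (h ᵥ* ((b⁻¹ : Matrix.SpecialLinearGroup ι ℤ) : Matrix ι ι ℤ))
    (s ᵥ* ((b⁻¹ : Matrix.SpecialLinearGroup ι ℤ) : Matrix ι ι ℤ))
    (by rw [key, hw]) (by rw [key, hs])
  convert hγ'
  apply Subtype.ext
  rw [coe_conj b e, e', smul_vecMul]

end HasTransvection

end Transvections

section Transvections
variable {ι : Type*} [Fintype ι] [DecidableEq ι]

theorem mul_one_add_vecMulVec_single_apply (γ : Matrix ι ι ℤ) (i j : ι) (c : ℤ) (a b : ι) :
    ((1 + vecMulVec (Pi.single i 1) (c • Pi.single j 1) : Matrix ι ι ℤ) * γ) a b =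
      γ a b + if a = i then c * γ j b else 0 := by
  rw [add_mul, one_mul, vecMulVec_mul, Matrix.add_apply, vecMulVec_apply, smul_vecMul,
    single_one_vecMul]
  by_cases h : a = i <;> simp [h, Matrix.row]

/-- A subgroup containing all elementary transvections contains every matrix having, for every
index in `S`, the same row and column as the identity. -/
theorem mem_of_forall_row_col {H : Subgroup (Matrix.SpecialLinearGroup ι ℤ)}
    (hT : ∀ i j : ι, i ≠ j → HasTransvection H (Pi.single i 1) (Pi.single j 1)) (S : Finset ι)
    (γ : Matrix.SpecialLinearGroup ι ℤ)
    (hS : ∀ i ∈ S, ∀ j, (γ : Matrix ι ι ℤ) i j = (1 : Matrix ι ι ℤ) i j ∧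
      (γ : Matrix ι ι ℤ) j i = (1 : Matrix ι ι ℤ) j i) : γ ∈ H := by
  have hT' : ∀ i j : ι, i ≠ j → ∀ c : ℤ,
      HasTransvection H (Pi.single i 1) (c • Pi.single j 1) := fun i j hij c =>
    HasTransvection.smul_right (by simp [hij]) (hT i j hij) c
  induction hc : Sᶜ.card using Nat.strong_induction_on generalizing S γ with
  | _ c ih =>
  subst hc
  by_cases hSu : Sᶜ = ∅
  · have : γ = 1 := by
      apply Subtype.ext
      ext i j
      exact (hS i (by rw [Finset.compl_eq_empty_iff] at hSu; simp [hSu]) j).1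
    rw [this]
    exact H.one_mem
  obtain ⟨k, hk⟩ := Finset.nonempty_iff_ne_empty.2 hSu
  rw [Finset.mem_compl] at hk
  -- once the column of index `k` is cleared, so can be the row
  have hrow : ∀ γ : Matrix.SpecialLinearGroup ι ℤ,
      (∀ i ∈ S, ∀ j, (γ : Matrix ι ι ℤ) i j = (1 : Matrix ι ι ℤ) i j ∧
        (γ : Matrix ι ι ℤ) j i = (1 : Matrix ι ι ℤ) j i) →
      (∀ j, (γ : Matrix ι ι ℤ) j k = (1 : Matrix ι ι ℤ) j k) → γ ∈ H := by
    intro γ hγ hcol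
    set r : ι → ℤ := Pi.single k 1 - (γ : Matrix ι ι ℤ) k with hr
    have hrk : r k = 0 := by simp [hr, hcol k]
    have hrS : ∀ i ∈ S, r i = 0 := fun i hi => by
      have : k ≠ i := fun h => hk (h ▸ hi)
      simp [hr, (hγ i hi k).2, this, this.symm]
    obtain ⟨ε, hε, e⟩ : HasTransvection H (Pi.single k 1) r := by
      have : r = ∑ i, r i • (Pi.single i 1 : ι → ℤ) := by
        ext a; simp [Finset.sum_apply, Pi.single_apply]
      rw [this]
      refine HasTransvection.sum_right _ _ (fun i _ => ?_) (fun i _ => ?_)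
      · by_cases hik : i = k <;> simp [hik, hrk]
      · by_cases hik : k = i
        · subst hik; rw [hrk, zero_smul]; exact HasTransvection.zero_right
        · exact hT' k i hik _
    have hγε : ((γ * ε : Matrix.SpecialLinearGroup ι ℤ) : Matrix ι ι ℤ) =
        (γ : Matrix ι ι ℤ) + vecMulVec (Pi.single k 1) r := by
      rw [Matrix.SpecialLinearGroup.coe_mul, e, mul_add, mul_one, mul_vecMulVec]
      congr 2
      ext a
      simp [hcol a, Matrix.one_apply, Pi.single_apply]
    refine (H.mul_mem_cancel_right hε).1 (ih _ ?_ (insert k S) (γ * ε) ?_ rfl)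
    · rw [Finset.compl_insert]
      exact Finset.card_erase_lt_of_mem (Finset.mem_compl.2 hk)
    · intro i hi j
      rw [hγε]
      simp only [Matrix.add_apply, vecMulVec_apply]
      rcases Finset.mem_insert.1 hi with rfl | hi
      · constructor
        · simp [hr, Pi.single_apply, Matrix.one_apply, eq_comm]
        · simp [hrk, hcol j]
      · have : i ≠ k := fun h => hk (h ▸ hi)
        constructor
        · simp [this, (hγ i hi j).1]
        · simp [hrS i hi, (hγ i hi j).2]
  -- Left multiplication by an elementary transvection whose indices avoid `S`.
  have hstep : ∀ γ : Matrix.SpecialLinearGroup ι ℤ,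
      (∀ i ∈ S, ∀ j, (γ : Matrix ι ι ℤ) i j = (1 : Matrix ι ι ℤ) i j ∧
        (γ : Matrix ι ι ℤ) j i = (1 : Matrix ι ι ℤ) j i) → ∀ i j c, i ∉ S → j ∉ S → i ≠ j →
      ∃ γ' : Matrix.SpecialLinearGroup ι ℤ, (γ' ∈ H → γ ∈ H) ∧
      (∀ a b, (γ' : Matrix ι ι ℤ) a b =
        (γ : Matrix ι ι ℤ) a b + if a = i then c * (γ : Matrix ι ι ℤ) j b else 0) ∧
      (∀ i ∈ S, ∀ j, (γ' : Matrix ι ι ℤ) i j = (1 : Matrix ι ι ℤ) i j ∧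
        (γ' : Matrix ι ι ℤ) j i = (1 : Matrix ι ι ℤ) j i) := by
    intro γ hγ i j c hi hj hij
    obtain ⟨ε, hε, e⟩ := hT' i j hij c
    have key : ∀ a b, ((ε * γ : Matrix.SpecialLinearGroup ι ℤ) : Matrix ι ι ℤ) a b =
        (γ : Matrix ι ι ℤ) a b + if a = i then c * (γ : Matrix ι ι ℤ) j b else 0 := fun a b => by
      rw [Matrix.SpecialLinearGroup.coe_mul, e, mul_one_add_vecMulVec_single_apply]
    refine ⟨ε * γ, (H.mul_mem_cancel_left hε).1, key, fun l hl b => ?_⟩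
    have h1 : l ≠ i := fun h => hi (h ▸ hl)
    have h2 : j ≠ l := fun h => hj (h ▸ hl)
    rw [key, key, if_neg h1, (hγ l hl b).1, (hγ l hl b).2, (hγ l hl j).2]
    simp [h2]
  -- Euclidean algorithm on the column of index `k`.
  induction hμ : ∑ i, ((γ : Matrix ι ι ℤ) i k).natAbs using Nat.strong_induction_on
    generalizing γ with
  | _ μ ihμ =>
  subst hμ
  have hkS : ∀ i ∈ S, (γ : Matrix ι ι ℤ) i k = 0 := fun i hi => by
    rw [(hS i hi k).1, Matrix.one_apply_ne fun h : i = k => hk (h ▸ hi)]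
  by_cases htwo : ∃ i j, i ≠ j ∧ (γ : Matrix ι ι ℤ) i k ≠ 0 ∧ (γ : Matrix ι ι ℤ) j k ≠ 0 ∧
      ((γ : Matrix ι ι ℤ) j k).natAbs ≤ ((γ : Matrix ι ι ℤ) i k).natAbs
  · obtain ⟨i, j, hij, hi, hj, hle⟩ := htwo
    obtain ⟨c, hc⟩ : ∃ c : ℤ, ((γ : Matrix ι ι ℤ) i k + c * (γ : Matrix ι ι ℤ) j k).natAbs <
        ((γ : Matrix ι ι ℤ) i k).natAbs := by
      generalize (γ : Matrix ι ι ℤ) i k = x at *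
      generalize (γ : Matrix ι ι ℤ) j k = y at *
      by_cases h : 0 < x ↔ 0 < y
      · exact ⟨-1, by omega⟩
      · exact ⟨1, by omega⟩
    obtain ⟨γ', hγ', e, hS'⟩ := hstep γ hS i j c (fun h => hi (hkS i h)) (fun h => hj (hkS j h)) hij
    refine hγ' (ihμ _ ?_ γ' hS' rfl)
    refine Finset.sum_lt_sum (fun a _ => ?_) ⟨i, Finset.mem_univ _, ?_⟩
    · rw [e]
      split_ifs with h
      · subst h; exact hc.le
      · simp
    · rw [e, if_pos rfl]; exact hc
  have hinv : ((γ⁻¹ : Matrix.SpecialLinearGroup ι ℤ) : Matrix ι ι ℤ) * (γ : Matrix ι ι ℤ) = 1 := by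
    rw [← Matrix.SpecialLinearGroup.coe_mul]; simp
  obtain ⟨i, hi⟩ : ∃ i, (γ : Matrix ι ι ℤ) i k ≠ 0 := by
    by_contra! h
    have := congrFun (congrFun hinv k) k
    simp [Matrix.mul_apply, h] at this
  have hother : ∀ j, j ≠ i → (γ : Matrix ι ι ℤ) j k = 0 := by
    intro j hji
    by_contra h
    rcases le_total ((γ : Matrix ι ι ℤ) j k).natAbs ((γ : Matrix ι ι ℤ) i k).natAbs with h' | h'
    · exact htwo ⟨i, j, hji.symm, hi, h, h'⟩
    · exact htwo ⟨j, i, hji, h, hi, h'⟩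
  have hunit : IsUnit ((γ : Matrix ι ι ℤ) i k) := by
    have := congrFun (congrFun hinv k) k
    rw [Matrix.mul_apply, Finset.sum_eq_single i (fun j _ hj => by rw [hother j hj, mul_zero])
      (by simp), Matrix.one_apply_eq] at this
    exact IsUnit.of_mul_eq_one_right _ this
  have hiS : i ∉ S := fun h => hi (hkS i h)
  by_cases hik : i = k
  · subst hik
    rcases Int.isUnit_iff.1 hunit with h1 | h1
    · refine hrow γ hS fun j => ?_
      by_cases hj : j = i
      · rw [hj, h1, Matrix.one_apply_eq]
      · rw [hother j hj, Matrix.one_apply_ne hj]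
    by_cases hex : ∃ j, j ∉ S ∧ j ≠ i
    · obtain ⟨j, hjS, hji⟩ := hex
      obtain ⟨γ₁, hγ₁, e₁, hS₁⟩ := hstep γ hS j i (-1) hjS hk hji
      obtain ⟨γ₂, hγ₂, e₂, hS₂⟩ := hstep γ₁ hS₁ i j 2 hk hjS hji.symm
      obtain ⟨γ₃, hγ₃, e₃, hS₃⟩ := hstep γ₂ hS₂ j i (-1) hjS hk hji
      refine hγ₁ (hγ₂ (hγ₃ (hrow γ₃ hS₃ fun a => ?_)))
      simp only [e₃, e₂, e₁]
      by_cases hai : a = i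
      · subst hai
        simp [hji.symm, h1, hother j hji]
      · by_cases haj : a = j
        · subst haj
          simp [hji, hji.symm, h1, hother a hji]
        · simp [hai, haj, hother a hai]
    · push Not at hex
      have hdiag : (γ : Matrix ι ι ℤ) = diagonal fun a => if a = i then -1 else 1 := by
        ext a b
        by_cases hai : a = i
        · by_cases hbi : b = i
          · simp [hai, hbi, h1]
          · have hb : b ∈ S := by by_contra h; exact hbi (hex b h)
            rw [(hS b hb a).2]
            have : i ≠ b := Ne.symm hbi
            simp [hai, this]
        · have ha : a ∈ S := by by_contra h; exact hai (hex a h)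
          rw [(hS a ha b).1]
          by_cases hab : a = b
          · subst hab; simp [hai]
          · simp [hab]
      have hdet := γ.2
      rw [hdiag, det_diagonal, Finset.prod_ite_eq'] at hdet
      simp at hdet
  · obtain ⟨γ₁, hγ₁, e₁, hS₁⟩ := hstep γ hS k i ((γ : Matrix ι ι ℤ) i k) hk hiS (Ne.symm hik)
    obtain ⟨γ₂, hγ₂, e₂, hS₂⟩ := hstep γ₁ hS₁ i k (-(γ : Matrix ι ι ℤ) i k) hiS hk hik
    refine hγ₁ (hγ₂ (hrow γ₂ hS₂ fun a => ?_))
    have hsq := Int.isUnit_mul_self hunit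
    simp only [e₂, e₁]
    by_cases hai : a = i
    · subst hai
      simp [hik, hsq, hother k (Ne.symm hik)]
    · by_cases hak : a = k
      · subst hak
        simp [hai, hsq, hother a hai]
      · simp [hai, hak, hother a hai]

theorem eq_top_of_hasTransvection_single {H : Subgroup (Matrix.SpecialLinearGroup ι ℤ)}
    (hT : ∀ i j : ι, i ≠ j → HasTransvection H (Pi.single i 1) (Pi.single j 1)) : H = ⊤ :=
  (Subgroup.eq_top_iff' H).2 fun γ => mem_of_forall_row_col hT ∅ γ (by simp)

end Transvections

/-- A perfect group whose center has finite index is finite. -/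
theorem finite_of_finiteIndex_center_of_commutator_eq_top {Q : Type*} [Group Q]
    (hZ : (Subgroup.center Q).FiniteIndex) (hQ : commutator Q = ⊤) : Finite Q := by
  have : Finite (commutatorSet Q) := by
    refine Set.Finite.subset (Set.finite_range fun p : (Q ⧸ Subgroup.center Q) ×
      (Q ⧸ Subgroup.center Q) => ⁅p.1.out, p.2.out⁆) ?_
    rintro _ ⟨a, b, rfl⟩
    refine ⟨(a, b), ?_⟩
    obtain ⟨⟨z, hz⟩, ez⟩ := QuotientGroup.mk_out_eq_mul (Subgroup.center Q) a
    obtain ⟨⟨y, hy⟩, ey⟩ := QuotientGroup.mk_out_eq_mul (Subgroup.center Q) b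
    have hz' := Subgroup.mem_center_iff.1 hz
    have hy' := Subgroup.mem_center_iff.1 hy
    simp only [ez, ey, commutatorElement_def, _root_.mul_inv_rev]
    calc a * z * (b * y) * (z⁻¹ * a⁻¹) * (y⁻¹ * b⁻¹)
        = a * (z * (b * y)) * z⁻¹ * a⁻¹ * y⁻¹ * b⁻¹ := by group
      _ = a * b * (y * a⁻¹) * y⁻¹ * b⁻¹ := by rw [← hz' (b * y)]; group
      _ = a * b * a⁻¹ * b⁻¹ := by rw [← hy' a⁻¹]; group
  have h : Finite (commutator Q) := inferInstance
  rw [hQ] at h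
  exact Finite.of_equiv _ (Subgroup.topEquiv (G := Q)).toEquiv

theorem exists_isCoprime_add_mul {a c m : ℤ} (hm : m ≠ 0)
    (h : ∀ p : ℕ, p.Prime → (p : ℤ) ∣ m → (p : ℤ) ∣ a → ¬ (p : ℤ) ∣ c) :
    ∃ t : ℤ, IsCoprime (a + t * c) m := by
  classical
  set s : Finset ℕ := m.natAbs.primeFactors.filter fun p => ¬ (p : ℤ) ∣ a
  refine ⟨∏ p ∈ s, (p : ℤ), ?_⟩
  rw [Int.isCoprime_iff_gcd_eq_one]
  change Nat.Coprime _ _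
  refine Nat.Coprime.symm (Nat.coprime_of_dvd fun p hp hpm hpa => ?_)
  rw [← Int.natCast_dvd] at hpm hpa
  have hp' := Nat.prime_iff_prime_int.1 hp
  by_cases hpa' : (p : ℤ) ∣ a
  · rcases hp'.dvd_or_dvd ((dvd_add_right hpa').1 hpa) with h1 | h1
    · obtain ⟨q, hq, hpq⟩ := (hp'.dvd_finsetProd_iff _).1 h1
      rw [Finset.mem_filter, Nat.mem_primeFactors] at hq
      rw [Int.natCast_dvd_natCast, Nat.prime_dvd_prime_iff_eq hp hq.1.1] at hpq
      exact hq.2 (hpq ▸ hpa')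
    · exact h p hp hpm hpa' h1
  · refine hpa' ((dvd_add_left (Dvd.dvd.mul_right (Finset.dvd_prod_of_mem _ ?_) c)).1 hpa)
    rw [Finset.mem_filter, Nat.mem_primeFactors]
    exact ⟨⟨hp, Int.natCast_dvd.1 hpm, by simpa using hm⟩, hpa'⟩

/-- The stable range condition for `ℤ`: the coordinate `c` of a unimodular vector `(x, c)` can be
absorbed in two of the other coordinates. -/
theorem exists_unimodular_add {ι : Type*} [Fintype ι] [DecidableEq ι] {k p q : ι} (hpk : p ≠ k)
    (hqk : q ≠ k) (hpq : p ≠ q) (x s : ι → ℤ) (a c : ℤ) (hs : s k = 0)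
    (h : s ⬝ᵥ x + a * c = 1) :
    ∃ t t' : ℤ, ∃ r : ι → ℤ, r k = 0 ∧
      r ⬝ᵥ (x + c • (t • Pi.single p 1 + t' • Pi.single q 1)) = 1 := by
  by_cases hc : c = 0
  · exact ⟨0, 0, s, hs, by simpa [hc] using h⟩
  obtain ⟨t', ht'⟩ : ∃ t' : ℤ, x q + c * t' ≠ 0 := by
    by_cases hq : x q = 0
    · exact ⟨1, by simpa [hq] using hc⟩
    · exact ⟨0, by simpa using hq⟩
  set y : ι → ℤ := x + (c * t') • Pi.single q 1 with hy
  have hyq : y q ≠ 0 := by simpa [hy] using ht'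
  set S : Finset ι := (Finset.univ.erase k).erase p
  obtain ⟨m, hm⟩ := (IsPrincipalIdealRing.principal (Ideal.span (y '' S))).principal
  have hmy : ∀ i ∈ S, m ∣ y i := fun i hi => by
    rw [← Ideal.mem_span_singleton, ← Ideal.submodule_span_eq, ← hm]
    exact Ideal.subset_span ⟨i, hi, rfl⟩
  have hqS : q ∈ S := by simp [S, hqk, hpq.symm]
  have hm0 : m ≠ 0 := fun h0 => hyq (by simpa [h0] using hmy q hqS)
  have hyi : ∀ i, x i = y i - c * (t' * if i = q then 1 else 0) := fun i => by
    simp [hy, Pi.single_apply]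
  obtain ⟨t, u, v, huv⟩ := exists_isCoprime_add_mul (a := y p) (c := c) hm0
      fun l hl hlm hlp hlc => by
    have h1 : (l : ℤ) ∣ s ⬝ᵥ x + a * c := by
      refine dvd_add (Finset.dvd_sum fun i _ => ?_) (hlc.mul_left a)
      by_cases hik : i = k
      · simp [hik, hs]
      refine Dvd.dvd.mul_left ?_ _
      rw [hyi i]
      refine dvd_sub ?_ (hlc.mul_right _)
      by_cases hip : i = p
      · rw [hip]; exact hlp
      · exact hlm.trans (hmy i (by simp [S, hik, hip]))
    rw [h] at h1
    exact hl.one_lt.ne' (by exact_mod_cast Int.eq_one_of_dvd_one (by positivity) h1)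
  have hmem : m ∈ Ideal.span (y '' S) := by
    rw [hm]; exact Submodule.mem_span_singleton_self m
  obtain ⟨r, hr⟩ := (Submodule.mem_span_image_finset_iff_exists_fun' ℤ).1 hmem
  refine ⟨t, t', fun i => if i = p then u else if i ∈ S then v * r i else 0, ?_, ?_⟩
  · simp [hpk.symm, S]
  · have hz : ∀ i, (x + c • (t • Pi.single p 1 + t' • Pi.single q 1) : ι → ℤ) i =
        y i + if i = p then t * c else 0 := fun i => by
      simp [hy, Pi.single_apply]
      split_ifs <;> ring
    have h1 : ∀ i, (if i = p then u else if i ∈ S then v * r i else 0) *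
        (y i + if i = p then t * c else 0) = (if i = p then u * (y p + t * c) else 0) +
          if i ∈ S then v * (r i * y i) else 0 := fun i => by
      by_cases hip : i = p
      · simp [hip, S]
      · simp only [hip, if_false]
        split_ifs <;> ring
    simp only [dotProduct, hz, h1, Finset.sum_add_distrib, Finset.sum_ite_eq', Finset.mem_univ,
      if_true, Finset.sum_ite_mem, Finset.univ_inter, ← Finset.mul_sum]
    simp only [smul_eq_mul] at hr
    rw [hr, huv]

section FiniteIndex
variable {ι : Type*} [Fintype ι] [DecidableEq ι]

theorem exists_mulVec_eq_single {E : Subgroup (Matrix.SpecialLinearGroup ι ℤ)} {M : ℤ}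
    (hι : 3 ≤ Fintype.card ι)
    (hE : ∀ w h s : ι → ℤ, h ⬝ᵥ w = 0 → s ⬝ᵥ w = 1 → HasTransvection E w (M • h))
    (k : ι) (x s : ι → ℤ) (hs : s ⬝ᵥ (Pi.single k 1 + M • x) = 1) :
    ∃ ε ∈ E, (ε : Matrix ι ι ℤ) *ᵥ (Pi.single k 1 + M • x) = Pi.single k 1 := by
  obtain ⟨p, hpk⟩ := Finset.exists_mem_ne (s := Finset.univ)
    (by rw [Finset.card_univ]; omega) k
  obtain ⟨q, hq⟩ : (({k, p} : Finset ι)ᶜ).Nonempty := by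
    rw [← Finset.card_pos, Finset.card_compl]
    have := Finset.card_le_two (a := k) (b := p)
    omega
  simp only [Finset.mem_compl, Finset.mem_insert, Finset.mem_singleton, not_or] at hq
  set c : ℤ := 1 + M * x k with hc
  set s' : ι → ℤ := M • (s - s k • Pi.single k 1) with hs'
  obtain ⟨t, t', r, hrk, hr⟩ := exists_unimodular_add hpk.2 hq.1 (Ne.symm hq.2) x s' (s k) c
    (by simp [hs']) (by
      rw [← hs, hs', hc]
      simp only [smul_dotProduct, sub_dotProduct, dotProduct_add, dotProduct_smul,
        single_one_dotProduct, dotProduct_single_one, smul_eq_mul]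
      ring)
  set w : ι → ℤ := t • Pi.single p 1 + t' • Pi.single q 1 with hw
  have hwk : w k = 0 := by simp [hw, hpk.2.symm, Ne.symm hq.1]
  obtain ⟨ε₁, hε₁, e₁⟩ : HasTransvection E w (M • Pi.single k 1) := by
    refine HasTransvection.add_left (by rw [smul_dotProduct, dotProduct_smul]; simp [hq.1])
      (HasTransvection.smul_left (by simp [hpk.2]) (hE _ _ (Pi.single p 1) (by simp [hpk.2]) (by simp)) _)
      (HasTransvection.smul_left (by simp [hq.1])
      (hE _ _ (Pi.single q 1) (by simp [hq.1]) (by simp)) _)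
  set x' : ι → ℤ := x + c • w with hx'
  have hx'k : x' k = x k := by simp [hx', hwk]
  have h1 : (ε₁ : Matrix ι ι ℤ) *ᵥ (Pi.single k 1 + M • x) = Pi.single k 1 + M • x' := by
    rw [e₁, add_mulVec, one_mulVec, vecMulVec_mulVec, op_smul_eq_smul]
    have : (M • Pi.single k 1 : ι → ℤ) ⬝ᵥ (Pi.single k 1 + M • x) = M * c := by
      simp only [smul_dotProduct, single_one_dotProduct, Pi.add_apply, Pi.smul_apply, hc,
        smul_eq_mul, Pi.single_eq_same]
    rw [this, hx']
    module
  set h : ι → ℤ := Pi.single k 1 - x k • r with hh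
  have hhx' : h ⬝ᵥ x' = 0 := by
    rw [hh, sub_dotProduct, smul_dotProduct, hr, single_one_dotProduct, hx'k]
    simp
  have hhk : h k = 1 := by simp [hh, hrk]
  obtain ⟨ε₂, hε₂, e₂⟩ := HasTransvection.neg_right (by rw [smul_dotProduct, hhx', smul_zero])
    (hE x' h r hhx' hr)
  refine ⟨ε₂ * ε₁, E.mul_mem hε₂ hε₁, ?_⟩
  rw [Matrix.SpecialLinearGroup.coe_mul, ← mulVec_mulVec, h1, e₂, add_mulVec, one_mulVec,
    vecMulVec_mulVec, op_smul_eq_smul]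
  have : (-(M • h)) ⬝ᵥ (Pi.single k 1 + M • x') = -M := by
    rw [neg_dotProduct, smul_dotProduct, dotProduct_add, dotProduct_smul, hhx',
      dotProduct_single_one, hhk]
    simp
  rw [this]
  module

variable (ι) in
/-- The principal congruence subgroup of level `M`. -/
def congruenceSubgroup (M : ℕ) : Subgroup (Matrix.SpecialLinearGroup ι ℤ) :=
  (Matrix.SpecialLinearGroup.map (Int.castRingHom (ZMod M))).ker

theorem mem_congruenceSubgroup {M : ℕ} {γ : Matrix.SpecialLinearGroup ι ℤ} :
    γ ∈ congruenceSubgroup ι M ↔ ∃ X : Matrix ι ι ℤ, (γ : Matrix ι ι ℤ) = 1 + (M : ℤ) • X := by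
  have h : γ ∈ congruenceSubgroup ι M ↔ ∀ i j, (M : ℤ) ∣ (γ : Matrix ι ι ℤ) i j -
      (1 : Matrix ι ι ℤ) i j := by
    rw [congruenceSubgroup, MonoidHom.mem_ker, Matrix.SpecialLinearGroup.ext_iff]
    refine forall_congr' fun i => forall_congr' fun j => ?_
    rw [← ZMod.intCast_zmod_eq_zero_iff_dvd, Int.cast_sub, sub_eq_zero]
    simp [Matrix.one_apply]
  rw [h]
  constructor
  · intro h
    choose X hX using h
    refine ⟨of X, ?_⟩
    ext i j
    rw [Matrix.add_apply, Matrix.smul_apply, of_apply, smul_eq_mul, ← hX]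
    ring
  · rintro ⟨X, hX⟩ i j
    rw [hX]
    exact ⟨X i j, by rw [Matrix.add_apply, Matrix.smul_apply, smul_eq_mul, add_sub_cancel_left]⟩

instance (M : ℕ) : (congruenceSubgroup ι M).Normal := MonoidHom.normal_ker _

theorem finiteIndex_congruenceSubgroup {M : ℕ} (hM : M ≠ 0) :
    (congruenceSubgroup ι M).FiniteIndex := by
  have : NeZero M := ⟨hM⟩
  have : Finite (Matrix.SpecialLinearGroup ι (ZMod M)) := Subtype.finite
  exact Subgroup.finiteIndex_ker _

theorem commutator_mem_of_mem_congruenceSubgroup {E : Subgroup (Matrix.SpecialLinearGroup ι ℤ)}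
    [E.Normal] {M : ℕ} (hι : 3 ≤ Fintype.card ι) (hEM : E ≤ congruenceSubgroup ι M)
    (hE : ∀ w h s : ι → ℤ, h ⬝ᵥ w = 0 → s ⬝ᵥ w = 1 → HasTransvection E w ((M : ℤ) • h))
    {γ : Matrix.SpecialLinearGroup ι ℤ} (hγ : γ ∈ congruenceSubgroup ι M) {k j : ι} (hkj : k ≠ j)
    {η : Matrix.SpecialLinearGroup ι ℤ}
    (hη : (η : Matrix ι ι ℤ) = 1 + vecMulVec (Pi.single k 1) (Pi.single j 1)) :
    (γ : Matrix.SpecialLinearGroup ι ℤ ⧸ E) * η = η * γ := by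
  obtain ⟨ε, hε, e⟩ : ∃ ε ∈ E, (ε : Matrix ι ι ℤ) *ᵥ ((γ : Matrix ι ι ℤ) *ᵥ Pi.single k 1) =
      Pi.single k 1 := by
    obtain ⟨X, hX⟩ := mem_congruenceSubgroup.1 hγ
    have hc : (γ : Matrix ι ι ℤ) *ᵥ Pi.single k 1 =
        Pi.single k 1 + (M : ℤ) • (X *ᵥ Pi.single k 1) := by
      rw [hX, add_mulVec, one_mulVec, smul_mulVec]
    rw [hc]
    refine exists_mulVec_eq_single hι hE k _
      (Pi.single k 1 ᵥ* ((γ⁻¹ : Matrix.SpecialLinearGroup ι ℤ) : Matrix ι ι ℤ)) ?_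
    rw [← hc, dotProduct_mulVec, vecMul_vecMul, ← Matrix.SpecialLinearGroup.coe_mul,
      inv_mul_cancel, Matrix.SpecialLinearGroup.coe_one, vecMul_one]
    simp
  set δ := ε * γ with hδ
  have hδE : (γ : Matrix.SpecialLinearGroup ι ℤ ⧸ E) = δ := by
    rw [hδ, QuotientGroup.mk_mul, (QuotientGroup.eq_one_iff ε).2 hε, one_mul]
  rw [mulVec_mulVec, ← Matrix.SpecialLinearGroup.coe_mul, ← hδ] at e
  have hδM : δ⁻¹ ∈ congruenceSubgroup ι M :=
    (congruenceSubgroup ι M).inv_mem ((congruenceSubgroup ι M).mul_mem (hEM hε) hγ)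
  obtain ⟨Y, hY⟩ := mem_congruenceSubgroup.1 hδM
  set z : ι → ℤ := Pi.single j 1 ᵥ* Y with hz
  have hconj := HasTransvection.coe_conj δ hη
  have hrow : (Pi.single j 1 : ι → ℤ) ᵥ* ((δ⁻¹ : Matrix.SpecialLinearGroup ι ℤ) : Matrix ι ι ℤ) =
      Pi.single j 1 + (M : ℤ) • z := by
    rw [hY, vecMul_add, vecMul_one, vecMul_smul]
  have hzk : ((M : ℤ) • z) ⬝ᵥ Pi.single k 1 = 0 := by
    have h1 : ((Pi.single j 1 : ι → ℤ) ᵥ* ((δ⁻¹ : Matrix.SpecialLinearGroup ι ℤ) : Matrix ι ι ℤ)) ⬝ᵥ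
        Pi.single k 1 = 0 := by
      conv_lhs => rw [← e]
      rw [dotProduct_mulVec, vecMul_vecMul, ← Matrix.SpecialLinearGroup.coe_mul,
        inv_mul_cancel, Matrix.SpecialLinearGroup.coe_one, vecMul_one]
      simp [hkj]
    rw [hrow, add_dotProduct] at h1
    simpa [hkj, -zsmul_eq_mul] using h1
  obtain ⟨ν, hν, eν⟩ : HasTransvection E (Pi.single k 1) ((M : ℤ) • z) := by
    by_cases hM : (M : ℤ) = 0
    · rw [hM, zero_smul]; exact HasTransvection.zero_right
    · refine hE _ z (Pi.single k 1) ?_ (by simp)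
      rw [smul_dotProduct, smul_eq_mul] at hzk
      exact (mul_eq_zero.1 hzk).resolve_left hM
  have hfin : δ * η * δ⁻¹ = ν * η := by
    apply Subtype.ext
    rw [hconj, e, hrow, Matrix.SpecialLinearGroup.coe_mul, eν, hη, mul_add, mul_one, add_mul,
      one_mul, vecMulVec_mul_vecMulVec, hzk, zero_smul, vecMulVec_zero, vecMulVec_add]
    abel
  rw [hδE, ← QuotientGroup.mk_mul, ← QuotientGroup.mk_mul]
  have : δ * η = ν * (η * δ) := by rw [← mul_assoc, ← hfin]; group
  rw [this, QuotientGroup.mk_mul, (QuotientGroup.eq_one_iff ν).2 hν, one_mul]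

theorem commutator_specialLinearGroup_eq_top (hι : 3 ≤ Fintype.card ι) :
    commutator (Matrix.SpecialLinearGroup ι ℤ) = ⊤ := by
  refine eq_top_of_hasTransvection_single fun i j hij => ?_
  obtain ⟨k, hk⟩ : (({i, j} : Finset ι)ᶜ).Nonempty := by
    rw [← Finset.card_pos, Finset.card_compl]
    have := Finset.card_le_two (a := i) (b := j)
    omega
  simp only [Finset.mem_compl, Finset.mem_insert, Finset.mem_singleton, not_or] at hk
  have hik : (Pi.single k 1 : ι → ℤ) ⬝ᵥ Pi.single i 1 = 0 := by simp [hk.1]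
  have hkj : (Pi.single j 1 : ι → ℤ) ⬝ᵥ Pi.single k 1 = 0 := by simp [Ne.symm hk.2]
  have hji : (Pi.single j 1 : ι → ℤ) ⬝ᵥ Pi.single i 1 = 0 := by simp [hij.symm]
  obtain ⟨γ, -, e⟩ := HasTransvection.exists_of_dotProduct_eq_zero hik
  obtain ⟨γ', -, e'⟩ := HasTransvection.exists_of_dotProduct_eq_zero hkj
  refine ⟨⁅γ, γ'⁆, Subgroup.commutator_mem_commutator trivial trivial, ?_⟩
  rw [HasTransvection.commutator hik hkj hji e e']
  simp

theorem finiteIndex_of_normal {E : Subgroup (Matrix.SpecialLinearGroup ι ℤ)}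
    [E.Normal] {M : ℕ} (hM : M ≠ 0) (hι : 3 ≤ Fintype.card ι) (hEM : E ≤ congruenceSubgroup ι M)
    (hE : ∀ w h s : ι → ℤ, h ⬝ᵥ w = 0 → s ⬝ᵥ w = 1 → HasTransvection E w ((M : ℤ) • h)) :
    E.FiniteIndex := by
  have hcenter : congruenceSubgroup ι M ≤ (Subgroup.center _).comap (QuotientGroup.mk' E) := by
    intro γ hγ
    have htop : (Subgroup.centralizer {(γ : Matrix.SpecialLinearGroup ι ℤ ⧸ E)}).comap
        (QuotientGroup.mk' E) = ⊤ := by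
      refine eq_top_of_hasTransvection_single fun k j hkj => ?_
      obtain ⟨η, -, e⟩ := HasTransvection.exists_of_dotProduct_eq_zero (w := Pi.single k 1)
        (h := Pi.single j 1) (by simp [hkj])
      refine ⟨η, ?_, e⟩
      rw [Subgroup.mem_comap, Subgroup.mem_centralizer_singleton_iff]
      exact (commutator_mem_of_mem_congruenceSubgroup hι hEM hE hγ hkj e).symm
    rw [Subgroup.mem_comap, Subgroup.mem_center_iff]
    intro q
    obtain ⟨b, rfl⟩ := QuotientGroup.mk'_surjective E q
    have hb : b ∈ (Subgroup.centralizer {(γ : Matrix.SpecialLinearGroup ι ℤ ⧸ E)}).comap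
        (QuotientGroup.mk' E) := htop ▸ trivial
    rw [Subgroup.mem_comap, Subgroup.mem_centralizer_singleton_iff] at hb
    exact hb
  have := finiteIndex_congruenceSubgroup (ι := ι) hM
  have hfin : (Subgroup.center (Matrix.SpecialLinearGroup ι ℤ ⧸ E)).FiniteIndex := by
    refine ⟨?_⟩
    rw [← Subgroup.index_comap_of_surjective _ (QuotientGroup.mk'_surjective E)]
    exact (Subgroup.finiteIndex_of_le hcenter).index_ne_zero
  have hperf : commutator (Matrix.SpecialLinearGroup ι ℤ ⧸ E) = ⊤ := by
    have h := congrArg (Subgroup.map (QuotientGroup.mk' E))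
      (commutator_specialLinearGroup_eq_top (ι := ι) hι)
    rwa [commutator_def, Subgroup.map_commutator,
      Subgroup.map_top_of_surjective _ (QuotientGroup.mk'_surjective E)] at h
  have := finite_of_finiteIndex_center_of_commutator_eq_top hfin hperf
  exact Subgroup.finiteIndex_of_finite_quotient

/-- A subgroup of `SL(n, ℤ)`, `n ≥ 3`, containing proportional elementary transvections for all
pairs of distinct vectors of some rational basis has finite index. -/
theorem finiteIndex_of_hasTransvection {H : Subgroup (Matrix.SpecialLinearGroup ι ℤ)}
    {P : Matrix ι ι ℤ} (hP : P.det ≠ 0) {N : ℤ} (hN : N ≠ 0) (hι : 3 ≤ Fintype.card ι)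
    (hT : ∀ i j, i ≠ j → HasTransvection H (P.col i) (N • P.adjugate.row j)) :
    H.FiniteIndex := by
  set M : ℕ := (N ^ 2 * P.det ^ 4).toNat with hM
  have hMpos : 0 < N ^ 2 * P.det ^ 4 := by positivity
  have hM' : (M : ℤ) = N ^ 2 * P.det ^ 4 := Int.toNat_of_nonneg hMpos.le
  have hcore : ∀ w h s : ι → ℤ, h ⬝ᵥ w = 0 → s ⬝ᵥ w = 1 →
      HasTransvection (H.normalCore ⊓ congruenceSubgroup ι M) w ((M : ℤ) • h) := by
    intro w h s hw hs
    obtain ⟨γ, hγ, e⟩ := HasTransvection.normalCore (H := H) (M := M) (fun w h s hw hs => by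
      rw [hM']; exact HasTransvection.of_basis hι hT hw hs) hw hs
    exact ⟨γ, ⟨hγ, mem_congruenceSubgroup.2 ⟨vecMulVec w h, by rw [e, vecMulVec_smul]⟩⟩, e⟩
  have : (H.normalCore ⊓ congruenceSubgroup ι M).Normal := inferInstance
  have : (H.normalCore ⊓ congruenceSubgroup ι M).FiniteIndex :=
    finiteIndex_of_normal (M := M) (by omega) hι inf_le_right hcore
  exact Subgroup.finiteIndex_of_le (H := H.normalCore ⊓ congruenceSubgroup ι M)
    (inf_le_left.trans H.normalCore_le)

end FiniteIndex

section Cyclic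

/-- The matrix whose columns are `v, A v, A² v, …`. -/
def krylov {R : Type*} [CommRing R] {n : ℕ} (A : Matrix (Fin n) (Fin n) R) (v : Fin n → R) :
    Matrix (Fin n) (Fin n) R :=
  of fun i j => ((A ^ (j : ℕ)) *ᵥ v) i

theorem exists_det_krylov_ne_zero_complex {n : ℕ} (A : Matrix (Fin n) (Fin n) ℂ)
    (hA : A.charpoly.roots.toFinset.card = n) : ∃ v, (krylov A v).det ≠ 0 := by
  let e := A.charpoly.roots.toFinset.equivFinOfCardEq hA
  let μ : Fin n → ℂ := fun i => (e.symm i : ℂ)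
  have hμ : Function.Injective μ := Subtype.val_injective.comp e.symm.injective
  have hev : ∀ i, ∃ b, Module.End.HasEigenvector (Matrix.toLin' A) (μ i) b := by
    intro i
    have h : A.charpoly.IsRoot (μ i) :=
      (Polynomial.mem_roots'.1 (Multiset.mem_toFinset.1 (e.symm i).2)).2
    rw [← Matrix.charpoly_toLin', ← Module.End.hasEigenvalue_iff_isRoot_charpoly] at h
    exact h.exists_hasEigenvector
  choose b hb using hev
  have hlin : LinearIndependent ℂ b :=
    Module.End.eigenvectors_linearIndependent' (Matrix.toLin' A) μ hμ b hb
  have hpow : ∀ i (k : ℕ), A ^ k *ᵥ b i = μ i ^ k • b i := by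
    intro i k
    have := (hb i).pow_apply k
    rwa [← Matrix.toLin'_pow, Matrix.toLin'_apply] at this
  refine ⟨∑ i, b i, ?_⟩
  have hK : krylov A (∑ i, b i) = (of b)ᵀ * vandermonde μ := by
    ext i j
    simp only [krylov, of_apply, mulVec_sum, hpow, Finset.sum_apply, Pi.smul_apply, smul_eq_mul,
      mul_apply, transpose_apply, vandermonde_apply]
    exact Finset.sum_congr rfl fun k _ => mul_comm _ _
  rw [hK, det_mul, det_transpose]
  refine mul_ne_zero ?_ (det_vandermonde_ne_zero_iff.2 hμ)
  exact ((Matrix.isUnit_iff_isUnit_det _).1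
    (Matrix.linearIndependent_rows_iff_isUnit.1 hlin)).ne_zero

theorem map_krylov {R S : Type*} [CommRing R] [CommRing S] (φ : R →+* S) {n : ℕ}
    (A : Matrix (Fin n) (Fin n) R) (v : Fin n → R) :
    (krylov A v).map φ = krylov (A.map φ) (φ ∘ v) := by
  ext i j
  rw [krylov, krylov, map_apply, of_apply, of_apply, RingHom.map_mulVec]
  simp [Matrix.map_pow]

theorem exists_det_krylov_ne_zero {n : ℕ} (A : Matrix (Fin n) (Fin n) ℤ)
    (hA : (A.map ((↑) : ℤ → ℂ)).charpoly.roots.toFinset.card = n) :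
    ∃ v, (krylov A v).det ≠ 0 := by
  by_contra! h
  obtain ⟨v, hv⟩ := exists_det_krylov_ne_zero_complex _ hA
  let K := krylov (A.map (MvPolynomial.C (σ := Fin n))) MvPolynomial.X
  have hK : K.det = 0 := by
    refine MvPolynomial.funext fun x => ?_
    rw [map_zero, RingHom.map_det, RingHom.mapMatrix_apply, map_krylov, Matrix.map_map, ← h x]
    congr 2
    · ext i j; simp
    · ext i; simp
  apply hv
  have h2 := congrArg (MvPolynomial.eval₂Hom (Int.castRingHom ℂ) v) hK
  rw [map_zero, RingHom.map_det, RingHom.mapMatrix_apply, map_krylov, Matrix.map_map] at h2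
  rw [← h2]
  congr 2
  · ext i j
    rw [map_apply, map_apply, Function.comp_apply, MvPolynomial.coe_eval₂Hom, MvPolynomial.eval₂_C,
      eq_intCast]
  · ext i; simp

end Cyclic

section Orbit
variable {n : ℕ} {g : Matrix.SpecialLinearGroup (Fin n) ℤ} {v f : Fin n → ℤ}
  {H : Subgroup (Matrix.SpecialLinearGroup (Fin n) ℤ)}

/-- The orbit of a column vector under the powers of `g`. -/
def colOrbit (g : Matrix.SpecialLinearGroup (Fin n) ℤ) (v : Fin n → ℤ) (k : ℤ) : Fin n → ℤ :=
  ((g ^ k : Matrix.SpecialLinearGroup (Fin n) ℤ) : Matrix (Fin n) (Fin n) ℤ) *ᵥ v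

/-- The orbit of a row vector under the inverse powers of `g`. -/
def rowOrbit (g : Matrix.SpecialLinearGroup (Fin n) ℤ) (f : Fin n → ℤ) (k : ℤ) : Fin n → ℤ :=
  f ᵥ* ((g ^ (-k) : Matrix.SpecialLinearGroup (Fin n) ℤ) : Matrix (Fin n) (Fin n) ℤ)

theorem colOrbit_zero : colOrbit g v 0 = v := by simp [colOrbit]

theorem rowOrbit_zero : rowOrbit g f 0 = f := by simp [rowOrbit]

theorem zpow_mulVec_colOrbit (i j : ℤ) :
    ((g ^ i : Matrix.SpecialLinearGroup (Fin n) ℤ) : Matrix (Fin n) (Fin n) ℤ) *ᵥ colOrbit g v j =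
      colOrbit g v (j + i) := by
  rw [colOrbit, colOrbit, mulVec_mulVec, ← Matrix.SpecialLinearGroup.coe_mul,
    ← _root_.zpow_add, add_comm]

theorem rowOrbit_vecMul_zpow (i j : ℤ) :
    rowOrbit g f j ᵥ*
        ((g ^ (-i) : Matrix.SpecialLinearGroup (Fin n) ℤ) : Matrix (Fin n) (Fin n) ℤ) =
      rowOrbit g f (j + i) := by
  rw [rowOrbit, rowOrbit, vecMul_vecMul, ← Matrix.SpecialLinearGroup.coe_mul,
    ← _root_.zpow_add, neg_add]

theorem rowOrbit_dotProduct_colOrbit (i j : ℤ) :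
    rowOrbit g f i ⬝ᵥ colOrbit g v j = f ⬝ᵥ colOrbit g v (j - i) := by
  rw [rowOrbit, ← dotProduct_mulVec, zpow_mulVec_colOrbit, sub_eq_add_neg]

theorem krylov_col (i : Fin n) :
    (krylov (g : Matrix (Fin n) (Fin n) ℤ) v).col i = colOrbit g v (i : ℕ) := by
  ext j
  simp [krylov, colOrbit, col_apply]

theorem HasTransvection.conj_zpow {w h : Fin n → ℤ} (hg : g ∈ H) (hT : HasTransvection H w h)
    (k : ℤ) : HasTransvection H
      (((g ^ k : Matrix.SpecialLinearGroup (Fin n) ℤ) : Matrix (Fin n) (Fin n) ℤ) *ᵥ w)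
      (h ᵥ* ((g ^ (-k) : Matrix.SpecialLinearGroup (Fin n) ℤ) : Matrix (Fin n) (Fin n) ℤ)) := by
  rw [_root_.zpow_neg]
  exact hT.conj (H.zpow_mem hg k)

theorem HasTransvection.orbit {m : ℤ} (hg : g ∈ H) (hT : HasTransvection H v (m • f)) (k : ℤ) :
    HasTransvection H (colOrbit g v k) (m • rowOrbit g f k) := by
  have := hT.conj_zpow hg k
  rwa [smul_vecMul] at this

theorem exists_hasTransvection_rowOrbit {m : ℤ} (hg : g ∈ H)
    (hT : HasTransvection H v (m • f)) (hm : m ≠ 0) (hneg : f ⬝ᵥ colOrbit g v (-1) ≠ 0) (d : ℕ)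
    (hf : ∀ k : ℕ, k ≤ d → f ⬝ᵥ colOrbit g v k = 0) :
    ∃ N : ℤ, N ≠ 0 ∧ HasTransvection H v (N • rowOrbit g f (-d)) := by
  induction d with
  | zero => exact ⟨m, hm, by simpa [rowOrbit_zero, -zsmul_eq_mul] using hT⟩
  | succ d ih =>
    obtain ⟨N, hN, h⟩ := ih fun k hk => hf k (by omega)
    have hd : rowOrbit g f (-d) ⬝ᵥ colOrbit g v 0 = 0 := by
      rw [rowOrbit_dotProduct_colOrbit, zero_sub, neg_neg, hf d (by omega)]
    have hd' : rowOrbit g f (-(d + 1 : ℕ)) ⬝ᵥ colOrbit g v 0 = 0 := by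
      rw [rowOrbit_dotProduct_colOrbit, zero_sub, neg_neg, hf _ le_rfl]
    have h0 : rowOrbit g f (-(d + 1 : ℕ)) ⬝ᵥ colOrbit g v (-(d + 1 : ℕ)) = 0 := by
      rw [rowOrbit_dotProduct_colOrbit, sub_self]
      exact_mod_cast hf 0 (by omega)
    have h1 : rowOrbit g f (-d) ⬝ᵥ colOrbit g v (-(d + 1 : ℕ)) = f ⬝ᵥ colOrbit g v (-1) := by
      rw [rowOrbit_dotProduct_colOrbit]
      congr 2
      push_cast
      ring
    rw [colOrbit_zero] at hd hd'
    have := HasTransvection.of_commutator (by rw [smul_dotProduct, hd, smul_zero])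
      (by rw [smul_dotProduct, h0, smul_zero]) (by rw [smul_dotProduct, hd', smul_zero]) h
      (hT.orbit hg (-(d + 1 : ℕ)))
    rw [smul_dotProduct, h1, smul_smul, smul_eq_mul] at this
    exact ⟨_, mul_ne_zero (mul_ne_zero hN hneg) hm, this⟩

theorem dotProduct_colOrbit_neg_one_ne_zero
    (hP : (krylov (g : Matrix (Fin n) (Fin n) ℤ) v).det ≠ 0)
    (hf : ∀ k : ℕ, k + 1 < n → f ⬝ᵥ colOrbit g v k = 0) (hf0 : f ≠ 0) :
    f ⬝ᵥ colOrbit g v (-1) ≠ 0 := by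
  intro h
  have h1 : rowOrbit g f 1 ᵥ* krylov (g : Matrix (Fin n) (Fin n) ℤ) v = 0 := by
    ext ⟨i, hi⟩
    change rowOrbit g f 1 ⬝ᵥ (krylov (g : Matrix (Fin n) (Fin n) ℤ) v).col ⟨i, hi⟩ = 0
    rw [krylov_col, rowOrbit_dotProduct_colOrbit]
    rcases i with _ | i
    · simpa using h
    · rw [← hf i hi]
      congr 2
      push_cast
      ring
  have h2 : rowOrbit g f 1 = 0 := eq_zero_of_vecMul_eq_zero hP h1
  apply hf0
  rw [← rowOrbit_zero (g := g) (f := f), ← add_neg_cancel (1 : ℤ), ← rowOrbit_vecMul_zpow, h2,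
    zero_vecMul]

theorem exists_hasTransvection_of_dotProduct_eq_zero {m : ℤ} (hg : g ∈ H)
    (hT : HasTransvection H v (m • f)) (hm : m ≠ 0) (hneg : f ⬝ᵥ colOrbit g v (-1) ≠ 0)
    (hf : ∀ k : ℕ, k + 1 < n → f ⬝ᵥ colOrbit g v k = 0)
    (hfn : ∀ k : ℕ, k + 1 = n → f ⬝ᵥ colOrbit g v k ≠ 0) {h : Fin n → ℤ} (hv : h ⬝ᵥ v = 0) :
    ∃ N : ℤ, N ≠ 0 ∧ HasTransvection H v (N • h) := by
  let R : Matrix (Fin n) (Fin n) ℤ := of fun i => rowOrbit g f (-(n - 1 - i : ℕ))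
  have hRP : ∀ i j : Fin n, (R * krylov (g : Matrix (Fin n) (Fin n) ℤ) v) i j =
      f ⬝ᵥ colOrbit g v ((j + (n - 1 - i) : ℕ)) := by
    intro i j
    change rowOrbit g f _ ⬝ᵥ (krylov (g : Matrix (Fin n) (Fin n) ℤ) v).col j = _
    rw [krylov_col, rowOrbit_dotProduct_colOrbit, sub_neg_eq_add, Nat.cast_add]
  have hR : R.det ≠ 0 := by
    have h1 : (R * krylov (g : Matrix (Fin n) (Fin n) ℤ) v).det ≠ 0 := by
      rw [det_of_isUpperTriangular, Finset.prod_ne_zero_iff]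
      · intro i _
        rw [hRP]
        exact hfn _ (by omega)
      · intro i j hij
        simp only [id_eq, Fin.lt_def] at hij
        rw [hRP]
        exact hf _ (by omega)
    rw [det_mul] at h1
    exact left_ne_zero_of_mul h1
  set c := h ᵥ* R.adjugate with hc
  have hsum : R.det • h = ∑ i, c i • R i := by
    rw [← vecMul_eq_sum, hc, vecMul_vecMul, adjugate_mul, vecMul_smul, vecMul_one]
  have hRv : ∀ i : Fin n, R i ⬝ᵥ v = f ⬝ᵥ colOrbit g v ((n - 1 - i : ℕ)) := by
    intro i
    change rowOrbit g f _ ⬝ᵥ v = _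
    conv_lhs => rw [← colOrbit_zero (g := g) (v := v), rowOrbit_dotProduct_colOrbit]
    rw [zero_sub, neg_neg]
  have hRv0 : ∀ i : Fin n, (i : ℕ) ≠ 0 → R i ⬝ᵥ v = 0 := fun i hi => by
    rw [hRv]
    exact hf _ (by omega)
  have hc0 : ∀ i : Fin n, (i : ℕ) = 0 → c i = 0 := by
    intro i hi
    have h1 := congrArg (· ⬝ᵥ v) hsum
    simp only [smul_dotProduct, hv, sum_dotProduct, smul_zero] at h1
    rw [Finset.sum_eq_single i (fun j _ hj => by
      rw [hRv0 j fun h => hj (Fin.ext (by omega)), smul_zero]) (by simp), smul_eq_mul] at h1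
    refine (mul_eq_zero.1 h1.symm).resolve_right ?_
    rw [hRv]
    exact hfn _ (by omega)
  have hN : ∀ i : Fin n, ∃ N : ℤ, N ≠ 0 ∧ ((i : ℕ) ≠ 0 → HasTransvection H v (N • R i)) := by
    intro i
    by_cases hi : (i : ℕ) = 0
    · exact ⟨1, one_ne_zero, fun h => absurd hi h⟩
    · obtain ⟨N, h1, h2⟩ := exists_hasTransvection_rowOrbit hg hT hm hneg (n - 1 - i)
        fun k hk => hf k (by omega)
      exact ⟨N, h1, fun _ => h2⟩
  choose N hN0 hN using hN
  refine ⟨(∏ i, N i) * R.det, mul_ne_zero (Finset.prod_ne_zero_iff.2 fun i _ => hN0 i) hR, ?_⟩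
  rw [mul_smul, hsum, Finset.smul_sum]
  have hterm : ∀ i, ((∏ i, N i) • c i • R i) ⬝ᵥ v = 0 ∧
      HasTransvection H v ((∏ i, N i) • c i • R i) := by
    intro i
    by_cases hi : (i : ℕ) = 0
    · rw [hc0 i hi, zero_smul, smul_zero]
      exact ⟨zero_dotProduct _, HasTransvection.zero_right⟩
    · refine ⟨by rw [smul_dotProduct, smul_dotProduct, hRv0 i hi, smul_zero, smul_zero], ?_⟩
      rw [← Finset.prod_erase_mul _ _ (Finset.mem_univ i)]
      have := HasTransvection.smul_right (by rw [smul_dotProduct, hRv0 i hi, smul_zero])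
        (hN i hi) ((∏ x ∈ Finset.univ.erase i, N x) * c i)
      convert this using 1
      module
  exact HasTransvection.sum_right _ _ (fun i _ => (hterm i).1) fun i _ => (hterm i).2

theorem finiteIndex_of_cyclic (hn : 3 ≤ n) {m : ℤ} (hg : g ∈ H)
    (hP : (krylov (g : Matrix (Fin n) (Fin n) ℤ) v).det ≠ 0)
    (hT : HasTransvection H v (m • f)) (hm : m ≠ 0)
    (hf : ∀ k : ℕ, k + 1 < n → f ⬝ᵥ colOrbit g v k = 0)
    (hfn : ∀ k : ℕ, k + 1 = n → f ⬝ᵥ colOrbit g v k ≠ 0) : H.FiniteIndex := by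
  have hf0 : f ≠ 0 := fun h => hfn (n - 1) (by omega) (by rw [h, zero_dotProduct])
  have hneg := dotProduct_colOrbit_neg_one_ne_zero hP hf hf0
  set P := krylov (g : Matrix (Fin n) (Fin n) ℤ) v with hPdef
  have hN : ∀ i j : Fin n, ∃ N : ℤ, N ≠ 0 ∧
      (i ≠ j → HasTransvection H (P.col i) (N • P.adjugate.row j)) := by
    intro i j
    by_cases hij : i = j
    · exact ⟨1, one_ne_zero, fun h => absurd hij h⟩
    have h0 : rowOrbit g (P.adjugate.row j) (-(i : ℕ)) ⬝ᵥ v = 0 := by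
      conv_lhs => rw [← colOrbit_zero (g := g) (v := v), rowOrbit_dotProduct_colOrbit]
      rw [zero_sub, neg_neg, ← krylov_col, adjugate_row_dotProduct_col]
      simp [Ne.symm hij]
    obtain ⟨N, hN, h⟩ := exists_hasTransvection_of_dotProduct_eq_zero hg hT hm hneg hf hfn h0
    refine ⟨N, hN, fun _ => ?_⟩
    have := h.conj_zpow hg (i : ℕ)
    rw [smul_vecMul, rowOrbit_vecMul_zpow, neg_add_cancel, rowOrbit_zero] at this
    rw [hPdef, krylov_col]
    exact this
  choose N hN0 hN using hN
  refine finiteIndex_of_hasTransvection hP (N := ∏ x : Fin n × Fin n, N x.1 x.2)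
    (Finset.prod_ne_zero_iff.2 fun x _ => hN0 _ _) (by rwa [Fintype.card_fin]) fun i j hij => ?_
  rw [← Finset.prod_erase_mul _ _ (Finset.mem_univ (i, j)), mul_smul]
  refine HasTransvection.smul_right ?_ (hN i j hij) _
  rw [smul_dotProduct, adjugate_row_dotProduct_col]
  simp [hij.symm]

end Orbit

end Auxiliary

/-- **Theorem.** Let `n ≥ 3` and `g ∈ SL(n,ℤ)`. If the discriminant of the characteristic
polynomial of `g` is nonzero — equivalently, `g` has `n` distinct complex eigenvalues,
i.e. the characteristic polynomial of `g` over `ℂ` has `n` distinct roots — then there is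
a unipotent `u ∈ SL(n,ℤ)` such that `⟨g, uᵐ⟩` has finite index in `SL(n,ℤ)` for all `m ≥ 1`. -/
theorem stmt2 (n : ℕ) (hn : 3 ≤ n) (g : Matrix.SpecialLinearGroup (Fin n) ℤ)
    (hdisc : (((g : Matrix (Fin n) (Fin n) ℤ).map
        ((↑) : ℤ → ℂ)).charpoly).roots.toFinset.card = n) :
    ∃ u : Matrix.SpecialLinearGroup (Fin n) ℤ,
      ((u : Matrix (Fin n) (Fin n) ℤ) - 1) ^ n = 0 ∧
      ∀ m : ℕ, 1 ≤ m → (Subgroup.closure {g, u ^ m}).FiniteIndex := by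
  obtain ⟨v, hP⟩ := exists_det_krylov_ne_zero _ hdisc
  set f := (krylov (g : Matrix (Fin n) (Fin n) ℤ) v).adjugate.row ⟨n - 1, by omega⟩ with hfdef
  have hf : ∀ k : ℕ, k + 1 < n → f ⬝ᵥ colOrbit g v k = 0 := by
    intro k hk
    have := adjugate_row_dotProduct_col (krylov (g : Matrix (Fin n) (Fin n) ℤ) v)
      ⟨n - 1, by omega⟩ ⟨k, by omega⟩
    rw [krylov_col] at this
    rw [hfdef, this, if_neg]
    rw [Fin.mk.injEq]
    omega
  have hfn : ∀ k : ℕ, k + 1 = n → f ⬝ᵥ colOrbit g v k ≠ 0 := by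
    intro k hk
    have := adjugate_row_dotProduct_col (krylov (g : Matrix (Fin n) (Fin n) ℤ) v)
      ⟨n - 1, by omega⟩ ⟨k, by omega⟩
    rw [krylov_col] at this
    rwa [hfdef, this, if_pos]
    rw [Fin.mk.injEq]
    omega
  have hfv : f ⬝ᵥ v = 0 := by
    rw [← hf 0 (by omega), Nat.cast_zero, colOrbit_zero]
  obtain ⟨u, -, hu⟩ := HasTransvection.exists_of_dotProduct_eq_zero hfv
  refine ⟨u, ?_, fun m hm => ?_⟩
  · rw [hu, add_sub_cancel_left]
    refine pow_eq_zero_of_le (m := 2) (by omega) ?_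
    rw [sq, Matrix.vecMulVec_mul_vecMulVec, hfv, zero_smul, Matrix.vecMulVec_zero]
  · have hpow : ∀ m : ℕ, ((u ^ m : Matrix.SpecialLinearGroup (Fin n) ℤ) :
        Matrix (Fin n) (Fin n) ℤ) = 1 + Matrix.vecMulVec v ((m : ℤ) • f) := by
      intro m
      induction m with
      | zero => simp
      | succ m ih =>
        rw [pow_succ, Matrix.SpecialLinearGroup.coe_mul, ih, hu, add_mul, one_mul, mul_add, mul_one,
          Matrix.vecMulVec_mul_vecMulVec, smul_dotProduct, hfv, smul_zero, zero_smul, Matrix.vecMulVec_zero,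
          Nat.cast_succ, add_smul, one_smul, Matrix.vecMulVec_add]
        abel
    exact finiteIndex_of_cyclic hn (m := m) (Subgroup.subset_closure (by simp)) hP
      ⟨u ^ m, Subgroup.subset_closure (by simp), hpow m⟩ (by exact_mod_cast (by omega : m ≠ 0))
      hf hfn
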